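/- Let X and X' be two ample simplicial complexes, and let L ⊆ X and L' ⊆ X' be finite induced subcomplexes. Then any isomorphism f : L → L' extends to an isomorphism F : X → X' with F restricted to L equal to f. -/

import Mathlib

/-- An (abstract) simplicial complex with vertices drawn from `ℕ`:
a set of nonempty finite subsets of `ℕ` (the simplexes) closed under
passing to nonempty subsets.  The vertex set `V(X)` is the set of `v`
with `{v}` a simplex. -/
structure SComplex where
  faces : Set (Finset ℕ)
  nonempty_of_mem : ∀ s ∈ faces, s.Nonempty
  down_closed : ∀ s ∈ faces, ∀ t ⊆ s, t.Nonempty → t ∈ faces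

namespace SComplex

/-- The vertex set of a simplicial complex. -/
def vertexSet (X : SComplex) : Set ℕ := {v | {v} ∈ X.faces}

/-- The subcomplex of `X` induced on a set `U` of vertices. -/
def induced (X : SComplex) (U : Set ℕ) : SComplex where
  faces := {s | s ∈ X.faces ∧ (↑s : Set ℕ) ⊆ U}
  nonempty_of_mem := fun s hs => X.nonempty_of_mem s hs.1
  down_closed := fun s hs t hts ht =>
    ⟨X.down_closed s hs.1 t hts ht,
     fun x hx => hs.2 (Finset.mem_coe.mpr (hts (Finset.mem_coe.mp hx)))⟩

/-- The link of a vertex `v`: all simplexes `σ` with `v ∉ σ` and `σ ∪ {v}` a simplex. -/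
def link (X : SComplex) (v : ℕ) : SComplex where
  faces := {s | s ∈ X.faces ∧ v ∉ s ∧ insert v s ∈ X.faces}
  nonempty_of_mem := fun s hs => X.nonempty_of_mem s hs.1
  down_closed := fun s hs t hts ht =>
    ⟨X.down_closed s hs.1 t hts ht,
     fun hv => hs.2.1 (hts hv),
     X.down_closed _ hs.2.2 _ (Finset.insert_subset_insert v hts)
       (Finset.insert_nonempty v t)⟩

/-- `IsIso X Y f` : the map `f` is an isomorphism of simplicial complexes from `X` to `Y`,
i.e. a bijection of the vertex sets which induces a bijection between the sets of simplexes. -/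
def IsIso (X Y : SComplex) (f : ℕ → ℕ) : Prop :=
  Set.BijOn f X.vertexSet Y.vertexSet ∧
    ∀ s : Finset ℕ, (↑s : Set ℕ) ⊆ X.vertexSet → (s ∈ X.faces ↔ s.image f ∈ Y.faces)

/-- Two simplicial complexes are isomorphic. -/
def Isomorphic (X Y : SComplex) : Prop := ∃ f, IsIso X Y f

/-- `X` is universal: every countable simplicial complex is isomorphic to an induced
subcomplex of `X`. -/
def Universal (X : SComplex) : Prop :=
  ∀ Y : SComplex, Y.vertexSet.Countable →
    ∃ U ⊆ X.vertexSet, Isomorphic Y (X.induced U)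

/-- `X` is homogeneous: every isomorphism between finite induced subcomplexes of `X`
extends to an isomorphism of `X` onto itself. -/
def Homogeneous (X : SComplex) : Prop :=
  ∀ U U' : Set ℕ, U.Finite → U'.Finite → U ⊆ X.vertexSet → U' ⊆ X.vertexSet →
    ∀ f : ℕ → ℕ, IsIso (X.induced U) (X.induced U') f →
      ∃ F : ℕ → ℕ, IsIso X X F ∧ Set.EqOn F f U

/-- A Rado complex: a countable simplicial complex which is universal and homogeneous. -/
def IsRado (X : SComplex) : Prop :=
  X.vertexSet.Countable ∧ Universal X ∧ Homogeneous X

/-- The ampleness condition: for every finite `U ⊆ V(X)` and every subcomplex `A` of the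
induced complex `X_U` there is a vertex `v ∈ V(X) - U` with `Lk_X(v) ∩ X_U = A`. -/
def AmpleProp (X : SComplex) : Prop :=
  ∀ U : Set ℕ, U.Finite → U ⊆ X.vertexSet →
    ∀ A : SComplex, A.faces ⊆ (X.induced U).faces →
      ∃ v ∈ X.vertexSet \ U, (X.link v).faces ∩ (X.induced U).faces = A.faces

/-- An ample complex: a countable simplicial complex satisfying the ampleness condition. -/
def IsAmple (X : SComplex) : Prop := X.vertexSet.Countable ∧ AmpleProp X

/-- `L'` is an induced subcomplex of `L`. -/
def IsInduced (L' L : SComplex) : Prop :=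
  L'.faces ⊆ L.faces ∧ ∀ s ∈ L.faces, (↑s : Set ℕ) ⊆ L'.vertexSet → s ∈ L'.faces

end SComplex

namespace SComplex

/-- A finite set `R` of pairs is (the graph of) an isomorphism between finite induced
subcomplexes of `X` and `Y`. -/
structure IsPartialIso (X Y : SComplex) (R : Finset (ℕ × ℕ)) : Prop where
  fst_mem : ∀ p ∈ R, p.1 ∈ X.vertexSet
  snd_mem : ∀ p ∈ R, p.2 ∈ Y.vertexSet
  fst_eq_iff : ∀ p ∈ R, ∀ q ∈ R, p.1 = q.1 ↔ p.2 = q.2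
  image_mem_iff : ∀ S ⊆ R, S.image Prod.fst ∈ X.faces ↔ S.image Prod.snd ∈ Y.faces

theorem vertexSet_induced {X : SComplex} {U : Set ℕ} (hU : U ⊆ X.vertexSet) :
    (X.induced U).vertexSet = U := by
  ext v
  constructor
  · rintro ⟨-, h⟩
    simpa using h
  · intro hv
    exact ⟨hU hv, by simpa using hv⟩

/-- For `v ∉ s` with `s` nonempty, `s` lies in the link of `v` iff `s ∪ {v}` is a simplex. -/
theorem mem_link_iff {X : SComplex} {v : ℕ} {s : Finset ℕ} (hs : s.Nonempty) (hv : v ∉ s) :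
    s ∈ (X.link v).faces ↔ insert v s ∈ X.faces :=
  ⟨fun h => h.2.2, fun h => ⟨X.down_closed _ h s (Finset.subset_insert v s) hs, hv, h⟩⟩

namespace IsPartialIso

variable {X Y : SComplex} {R : Finset (ℕ × ℕ)}

theorem swap (h : IsPartialIso X Y R) : IsPartialIso Y X (R.image Prod.swap) where
  fst_mem := by
    intro p hp
    obtain ⟨q, hq, rfl⟩ := Finset.mem_image.1 hp
    exact h.snd_mem q hq
  snd_mem := by
    intro p hp
    obtain ⟨q, hq, rfl⟩ := Finset.mem_image.1 hp
    exact h.fst_mem q hq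
  fst_eq_iff := by
    intro p' hp' q' hq'
    obtain ⟨p, hp, rfl⟩ := Finset.mem_image.1 hp'
    obtain ⟨q, hq, rfl⟩ := Finset.mem_image.1 hq'
    exact (h.fst_eq_iff p hp q hq).symm
  image_mem_iff := by
    intro S hS
    obtain ⟨T, hT, rfl⟩ := Finset.subset_image_iff.1 hS
    rw [Finset.image_image, Finset.image_image]
    exact (h.image_mem_iff T (by exact_mod_cast hT)).symm

/-- The subcomplex of `Y` corresponding under `R` to the link of `v` in `X`. -/
def linkImage (h : IsPartialIso X Y R) (v : ℕ) : SComplex where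
  faces := {t | ∃ S ⊆ R, S.image Prod.fst ∈ (X.link v).faces ∧ S.image Prod.snd = t}
  nonempty_of_mem := by
    rintro t ⟨S, hS, hf, rfl⟩
    exact Y.nonempty_of_mem _ ((h.image_mem_iff S hS).1 hf.1)
  down_closed := by
    rintro t ⟨S, hS, hf, rfl⟩ t' ht' hne
    have himage : (S.filter (fun p => p.2 ∈ t')).image Prod.snd = t' := by
      ext y
      simp only [Finset.mem_image, Finset.mem_filter]
      constructor
      · rintro ⟨p, hp, rfl⟩
        exact hp.2
      · intro hy
        obtain ⟨p, hp, rfl⟩ := Finset.mem_image.1 (ht' hy)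
        exact ⟨p, ⟨hp, hy⟩, rfl⟩
    refine ⟨S.filter (fun p => p.2 ∈ t'), (Finset.filter_subset _ _).trans hS, ?_, himage⟩
    refine (X.link v).down_closed _ hf _ (Finset.image_subset_image (Finset.filter_subset _ _)) ?_
    rw [← himage] at hne
    exact (Finset.image_nonempty.1 hne).image _

theorem image_fst_subset (h : IsPartialIso X Y R) {S T : Finset (ℕ × ℕ)} (hS : S ⊆ R)
    (hT : T ⊆ R) (hST : S.image Prod.snd ⊆ T.image Prod.snd) :
    S.image Prod.fst ⊆ T.image Prod.fst := by
  intro x hx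
  obtain ⟨p, hp, rfl⟩ := Finset.mem_image.1 hx
  obtain ⟨q, hq, hqp⟩ := Finset.mem_image.1 (hST (Finset.mem_image_of_mem _ hp))
  exact Finset.mem_image.2 ⟨q, hq, (h.fst_eq_iff q (hT hq) p (hS hp)).2 hqp⟩

theorem image_mem_linkImage (h : IsPartialIso X Y R) {v : ℕ} {S : Finset (ℕ × ℕ)}
    (hS : S ⊆ R) :
    S.image Prod.snd ∈ (h.linkImage v).faces ↔ S.image Prod.fst ∈ (X.link v).faces := by
  constructor
  · rintro ⟨T, hT, hf, hTS⟩
    rwa [← (h.image_fst_subset hT hS hTS.subset).antisymm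
      (h.image_fst_subset hS hT hTS.symm.subset)]
  · intro hf
    exact ⟨S, hS, hf, rfl⟩

theorem exists_insert (h : IsPartialIso X Y R) (hY : Y.AmpleProp) {v : ℕ}
    (hv : v ∈ X.vertexSet) (hvR : ∀ p ∈ R, p.1 ≠ v) :
    ∃ w, IsPartialIso X Y (insert (v, w) R) := by
  obtain ⟨w, ⟨hw, hwR⟩, hlink⟩ := hY (↑(R.image Prod.snd)) (Finset.finite_toSet _)
    (fun y hy => by
      obtain ⟨p, hp, rfl⟩ := Finset.mem_image.1 (Finset.mem_coe.1 hy)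
      exact h.snd_mem p hp)
    (h.linkImage v) (by
      rintro t ⟨S, hS, hf, rfl⟩
      exact ⟨(h.image_mem_iff S hS).1 hf.1,
        Finset.coe_subset.2 (Finset.image_subset_image hS)⟩)
  have hwR' : ∀ p ∈ R, p.2 ≠ w := fun p hp hpw =>
    hwR (Finset.mem_coe.2 (Finset.mem_image.2 ⟨p, hp, hpw⟩))
  refine ⟨w, ?_, ?_, ?_, ?_⟩
  · intro p hp
    rcases Finset.mem_insert.1 hp with rfl | hp
    exacts [hv, h.fst_mem p hp]
  · intro p hp
    rcases Finset.mem_insert.1 hp with rfl | hp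
    exacts [hw, h.snd_mem p hp]
  · intro p hp q hq
    rcases Finset.mem_insert.1 hp with rfl | hp <;> rcases Finset.mem_insert.1 hq with rfl | hq
    · simp
    · exact iff_of_false (hvR q hq).symm (hwR' q hq).symm
    · exact iff_of_false (hvR p hp) (hwR' p hp)
    · exact h.fst_eq_iff p hp q hq
  · intro S hS
    by_cases hmem : (v, w) ∈ S
    · obtain ⟨T, hT, rfl⟩ : ∃ T ⊆ R, S = insert (v, w) T :=
        ⟨S.erase (v, w), Finset.subset_insert_iff.1 hS, (Finset.insert_erase hmem).symm⟩
      rw [Finset.image_insert, Finset.image_insert]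
      rcases T.eq_empty_or_nonempty with rfl | hne
      · exact iff_of_true hv hw
      · have hvT : v ∉ T.image Prod.fst := fun hm => by
          obtain ⟨p, hp, hpv⟩ := Finset.mem_image.1 hm
          exact hvR p (hT hp) hpv
        have hwT : w ∉ T.image Prod.snd := fun hm => by
          obtain ⟨p, hp, hpw⟩ := Finset.mem_image.1 hm
          exact hwR' p (hT hp) hpw
        rw [← mem_link_iff (hne.image _) hvT, ← mem_link_iff (hne.image _) hwT,
          ← h.image_mem_linkImage hT, ← hlink]
        exact ⟨fun hf => hf.1, fun hf =>
          ⟨hf, hf.1, Finset.coe_subset.2 (Finset.image_subset_image hT)⟩⟩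
    · exact h.image_mem_iff S ((Finset.subset_insert_iff_of_notMem hmem).1 hS)

theorem exists_extend_fst (h : IsPartialIso X Y R) (hY : Y.AmpleProp) (v : ℕ) :
    ∃ R', IsPartialIso X Y R' ∧ R ⊆ R' ∧ (v ∈ X.vertexSet → ∃ p ∈ R', p.1 = v) := by
  by_cases hex : v ∈ X.vertexSet → ∃ p ∈ R, p.1 = v
  · exact ⟨R, h, subset_rfl, hex⟩
  · push Not at hex
    obtain ⟨w, hw⟩ := h.exists_insert hY hex.1 hex.2
    exact ⟨_, hw, Finset.subset_insert _ _, fun _ => ⟨(v, w), Finset.mem_insert_self _ _, rfl⟩⟩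

theorem exists_extend (h : IsPartialIso X Y R) (hX : X.AmpleProp) (hY : Y.AmpleProp) (v : ℕ) :
    ∃ R', IsPartialIso X Y R' ∧ R ⊆ R' ∧ (v ∈ X.vertexSet → ∃ p ∈ R', p.1 = v) ∧
      (v ∈ Y.vertexSet → ∃ p ∈ R', p.2 = v) := by
  obtain ⟨R₁, h₁, hR₁, hv₁⟩ := h.exists_extend_fst hY v
  obtain ⟨R₂, h₂, hR₂, hv₂⟩ := h₁.swap.exists_extend_fst hX v
  have hsub : R₁ ⊆ R₂.image Prod.swap := fun p hp =>
    Finset.mem_image.2 ⟨p.swap, hR₂ (Finset.mem_image_of_mem _ hp), p.swap_swap⟩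
  refine ⟨R₂.image Prod.swap, h₂.swap, hR₁.trans hsub, fun hv => ?_, fun hv => ?_⟩
  · obtain ⟨p, hp, hpv⟩ := hv₁ hv
    exact ⟨p, hsub hp, hpv⟩
  · obtain ⟨p, hp, hpv⟩ := hv₂ hv
    exact ⟨p.swap, Finset.mem_image_of_mem _ hp, hpv⟩

/-- The union of an exhausting chain of finite partial isomorphisms is an isomorphism. -/
theorem exists_isIso_of_chain {R : ℕ → Finset (ℕ × ℕ)} (hR : ∀ n, IsPartialIso X Y (R n))
    (hmono : Monotone R) (hfst : ∀ v ∈ X.vertexSet, ∃ n, ∃ p ∈ R n, p.1 = v)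
    (hsnd : ∀ v ∈ Y.vertexSet, ∃ n, ∃ p ∈ R n, p.2 = v) :
    ∃ F : ℕ → ℕ, IsIso X Y F ∧ ∀ n, ∀ p ∈ R n, F p.1 = p.2 := by
  have hex : ∀ v, ∃ w, v ∈ X.vertexSet → ∃ n, (v, w) ∈ R n := by
    intro v
    by_cases hv : v ∈ X.vertexSet
    · obtain ⟨n, p, hp, rfl⟩ := hfst v hv
      exact ⟨p.2, fun _ => ⟨n, hp⟩⟩
    · exact ⟨0, fun hv' => absurd hv' hv⟩
  choose F hF using hex
  have key : ∀ m, ∀ p ∈ R m, ∀ n, ∀ q ∈ R n, p.1 = q.1 ↔ p.2 = q.2 := fun m p hp n q hq =>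
    (hR (max m n)).fst_eq_iff p (hmono (le_max_left m n) hp) q (hmono (le_max_right m n) hq)
  have hFR : ∀ n, ∀ p ∈ R n, F p.1 = p.2 := by
    intro n p hp
    obtain ⟨m, hm⟩ := hF p.1 ((hR n).fst_mem p hp)
    exact (key m _ hm n p hp).1 rfl
  refine ⟨F, ⟨⟨?_, ?_, ?_⟩, ?_⟩, hFR⟩
  · intro v hv
    obtain ⟨n, hn⟩ := hF v hv
    exact (hR n).snd_mem _ hn
  · intro v hv w hw hvw
    obtain ⟨m, hm⟩ := hF v hv
    obtain ⟨n, hn⟩ := hF w hw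
    exact (key m _ hm n _ hn).2 hvw
  · intro w hw
    obtain ⟨n, p, hp, rfl⟩ := hsnd w hw
    exact ⟨p.1, (hR n).fst_mem p hp, hFR n p hp⟩
  · intro s hs
    have hn : ∃ n, ∀ v ∈ s, (v, F v) ∈ R n := by
      choose! N hN using hF
      exact ⟨s.sup N, fun v hv => hmono (Finset.le_sup hv) (hN v (hs hv))⟩
    obtain ⟨n, hn⟩ := hn
    have himage := (hR n).image_mem_iff (s.image fun v => (v, F v)) (fun p hp => by
      obtain ⟨v, hv, rfl⟩ := Finset.mem_image.1 hp
      exact hn v hv)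
    rw [Finset.image_image, Finset.image_image] at himage
    simpa [Function.comp_def] using himage

/-- A finite partial isomorphism between ample complexes extends to an isomorphism. -/
theorem exists_isIso (h : IsPartialIso X Y R) (hX : X.AmpleProp) (hY : Y.AmpleProp) :
    ∃ F : ℕ → ℕ, IsIso X Y F ∧ ∀ p ∈ R, F p.1 = p.2 := by
  choose! next hnext hsub hfst hsnd using
    fun (S : Finset (ℕ × ℕ)) (v : ℕ) (hS : IsPartialIso X Y S) => hS.exists_extend hX hY v
  let chain : ℕ → Finset (ℕ × ℕ) := fun n => Nat.rec R (fun n S => next S n) n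
  have hchain : ∀ n, IsPartialIso X Y (chain n) := by
    intro n
    induction n with
    | zero => exact h
    | succ n ih => exact hnext _ n ih
  obtain ⟨F, hF, hFR⟩ := exists_isIso_of_chain hchain
    (monotone_nat_of_le_succ fun n => hsub _ n (hchain n))
    (fun v hv => ⟨v + 1, hfst _ v (hchain v) hv⟩)
    (fun v hv => ⟨v + 1, hsnd _ v (hchain v) hv⟩)
  exact ⟨F, hF, hFR 0⟩

end IsPartialIso

theorem IsIso.isPartialIso {X Y : SComplex} {W W' : Set ℕ} (hW : W.Finite)
    (hWX : W ⊆ X.vertexSet) (hWY : W' ⊆ Y.vertexSet) {f : ℕ → ℕ}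
    (hf : IsIso (X.induced W) (Y.induced W') f) :
    IsPartialIso X Y (hW.toFinset.image fun v => (v, f v)) := by
  obtain ⟨hbij, hfaces⟩ := hf
  rw [vertexSet_induced hWX] at hfaces
  rw [vertexSet_induced hWX, vertexSet_induced hWY] at hbij
  have hmem : ∀ p ∈ hW.toFinset.image (fun v => (v, f v)), p.1 ∈ W ∧ f p.1 = p.2 := by
    intro p hp
    obtain ⟨v, hv, rfl⟩ := Finset.mem_image.1 hp
    exact ⟨hW.mem_toFinset.1 hv, rfl⟩
  refine ⟨fun p hp => hWX (hmem p hp).1, fun p hp => ?_, fun p hp q hq => ?_, fun S hS => ?_⟩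
  · rw [← (hmem p hp).2]
    exact hWY (hbij.mapsTo (hmem p hp).1)
  · rw [← (hmem p hp).2, ← (hmem q hq).2]
    exact (hbij.injOn.eq_iff (hmem p hp).1 (hmem q hq).1).symm
  · have hsnd : S.image Prod.snd = (S.image Prod.fst).image f := by
      rw [Finset.image_image]
      exact Finset.image_congr fun p hp => (hmem p (hS hp)).2.symm
    have hsub : (↑(S.image Prod.fst) : Set ℕ) ⊆ W := by
      intro x hx
      obtain ⟨p, hp, rfl⟩ := Finset.mem_image.1 (Finset.mem_coe.1 hx)
      exact (hmem p (hS hp)).1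
    have hsub' : (↑((S.image Prod.fst).image f) : Set ℕ) ⊆ W' := by
      rw [Finset.coe_image]
      exact (Set.image_mono hsub).trans hbij.mapsTo.image_subset
    rw [hsnd]
    exact ⟨fun hs => ((hfaces _ hsub).1 ⟨hs, hsub⟩).1, fun hs => ((hfaces _ hsub).2 ⟨hs, hsub'⟩).1⟩

end SComplex

/-- (Back-and-forth lemma.) Let `X`, `X'` be ample complexes and let
`L = X_W ⊆ X` and `L' = X'_{W'} ⊆ X'` be finite induced subcomplexes.  Any isomorphism
`f : L → L'` extends to an isomorphism `F : X → X'` with `F` equal to `f` on `L`. -/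
theorem ample_back_and_forth (X X' : SComplex) (hX : X.IsAmple) (hX' : X'.IsAmple)
    (W W' : Set ℕ) (hW : W.Finite) (hW' : W'.Finite)
    (hWsub : W ⊆ X.vertexSet) (hW'sub : W' ⊆ X'.vertexSet)
    (f : ℕ → ℕ) (hf : SComplex.IsIso (X.induced W) (X'.induced W') f) :
    ∃ F : ℕ → ℕ, SComplex.IsIso X X' F ∧ Set.EqOn F f W := by
  obtain ⟨F, hF, hFR⟩ :=
    (hf.isPartialIso hW hWsub hW'sub).exists_isIso hX.2 hX'.2
  exact ⟨F, hF, fun v hv =>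
    hFR (v, f v) (Finset.mem_image.2 ⟨v, hW.mem_toFinset.2 hv, rfl⟩)⟩
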